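/- arXiv:2512.00569 — 3 statements merged into one kernel-verified Lean document; each statement's English description precedes it below -/
import Mathlib

section
/- Let M and N be abelian groups, let r be a natural number, let f : M^r → N be a ℤ-multilinear map in r variables, and let a : Fin r → M. For S ⊆ Fin r write σ_S := ∑_{t∈S} a_t. Then ∑_{S ⊆ Fin r} (−1)^{r−|S|} · f(σ_S, σ_S, …, σ_S) = ∑_{π ∈ Perm(Fin r)} f(a_{π(1)}, a_{π(2)}, …, a_{π(r)}), the sum on the right running over all permutations π of Fin r. -/
theorem sum_superset_neg_one_pow_card_compl {α : Type*} [Fintype α] [DecidableEq α]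
    (T : Finset α) :
    ∑ S : Finset α with T ⊆ S, (-1 : ℤ) ^ (Fintype.card α - S.card)
      = if T = Finset.univ then 1 else 0 := by
  have key := Finset.sum_powerset_neg_one_pow_card (x := Tᶜ)
  simp only [Finset.compl_eq_empty_iff] at key
  rw [← key]
  refine Finset.sum_nbij' (fun S => Sᶜ) (fun S => Sᶜ) ?_ ?_ ?_ ?_ ?_
  · simp
  · intro S hS
    simpa [Finset.subset_compl_comm] using hS
  · simp
  · simp
  · simp [Finset.card_compl]

theorem Equiv.Perm.sum_eq_sum_surjective {α N : Type*} [Fintype α] [DecidableEq α]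
    [AddCommMonoid N] (g : (α → α) → N) :
    ∑ π : Equiv.Perm α, g π = ∑ l : α → α with Finset.univ.image l = Finset.univ, g l := by
  refine Finset.sum_bij (fun π _ => π) ?_ ?_ ?_ ?_
  · intro π _
    simp
  · intro π _ τ _ h
    exact DFunLike.coe_injective h
  · intro l hl
    have hs : Function.Surjective l := by
      intro x
      have hx : x ∈ Finset.univ.image l := by simp [(Finset.mem_filter.mp hl).2]
      simpa using hx
    exact ⟨Equiv.ofBijective l (Finite.surjective_iff_bijective.mp hs), Finset.mem_univ _, rfl⟩
  · simp

/-- Let `M`, `N` be abelian groups, `r : ℕ`, `f : M^r → N` a `ℤ`-multilinear map in `r`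
variables, and `a : Fin r → M`. For `S ⊆ Fin r` write `σ_S := ∑_{t ∈ S} a t`. Then
`∑_{S ⊆ Fin r} (-1)^(r - |S|) • f (σ_S, …, σ_S) = ∑_{π ∈ Perm (Fin r)} f (a ∘ π)`. -/
theorem stmt_5 (M N : Type*) [AddCommGroup M] [AddCommGroup N] (r : ℕ)
    (f : MultilinearMap ℤ (fun _ : Fin r => M) N) (a : Fin r → M) :
    ∑ S : Finset (Fin r),
      (-1 : ℤ) ^ (r - S.card) • f (fun _ => ∑ t ∈ S, a t)
      = ∑ π : Equiv.Perm (Fin r), f (fun i => a (π i)) := by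
  have expand (S : Finset (Fin r)) : f (fun _ => ∑ t ∈ S, a t)
      = ∑ l : Fin r → Fin r with Finset.univ.image l ⊆ S, f (fun i => a (l i)) := by
    rw [f.map_sum_finset (fun _ t => a t) (fun _ => S)]
    refine Finset.sum_congr ?_ fun _ _ => rfl
    ext l
    simp [Finset.image_subset_iff]
  simp_rw [expand, Finset.smul_sum, Finset.sum_filter]
  rw [Finset.sum_comm, Equiv.Perm.sum_eq_sum_surjective (fun l => f (fun i => a (l i))),
    Finset.sum_filter]
  refine Finset.sum_congr rfl fun l _ => ?_
  rw [← Finset.sum_filter, ← Finset.sum_smul]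
  have h := sum_superset_neg_one_pow_card_compl (Finset.univ.image l)
  rw [Fintype.card_fin] at h
  rw [h, ite_smul, one_smul, zero_smul]
end

section
/- Let M and N be abelian groups, let r be a natural number, let f : M^r → N be a ℤ-multilinear map that is symmetric (f(x∘π) = f(x) for every permutation π of Fin r), and let a : Fin r → M. For S ⊆ Fin r write σ_S := ∑_{t∈S} a_t. Then ∑_{S ⊆ Fin r} (−1)^{r−|S|} · f(σ_S, σ_S, …, σ_S) = r! · f(a_1, a_2, …, a_r). -/
/-- The signed count of the supersets of `A` vanishes unless `A` is everything. -/
theorem Finset.sum_superset_neg_one_pow_card_sub {α : Type*} [Fintype α] [DecidableEq α]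
    (A : Finset α) :
    ∑ S : Finset α with A ⊆ S, (-1 : ℤ) ^ (Fintype.card α - S.card) =
      if A = Finset.univ then 1 else 0 := by
  have h : ∑ S : Finset α with A ⊆ S, (-1 : ℤ) ^ (Fintype.card α - S.card) =
      ∑ T ∈ Aᶜ.powerset, (-1 : ℤ) ^ T.card := by
    refine Finset.sum_nbij' (fun S => Sᶜ) (fun T => Tᶜ) ?_ ?_ ?_ ?_ ?_
    · simp
    · simp [Finset.subset_compl_comm]
    · simp
    · simp
    · simp [Finset.card_compl]
  simp [h, Finset.sum_powerset_neg_one_pow_card]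

/-- Summing over the surjective self-maps of a finite type is summing over permutations. -/
theorem Finset.sum_filter_surjective_eq_sum_perm {α N : Type*} [Fintype α] [DecidableEq α]
    [AddCommMonoid N] (F : (α → α) → N) :
    ∑ g : α → α with Finset.univ.image g = Finset.univ, F g =
      ∑ π : Equiv.Perm α, F π := by
  symm
  refine Finset.sum_bij (fun π _ => (π : α → α)) ?_ ?_ ?_ ?_
  · simp
  · exact fun π _ ρ _ h => DFunLike.coe_injective h
  · intro g hg
    have hs : Function.Surjective g := by
      simpa [Finset.eq_univ_iff_forall, Function.Surjective] using hg
    exact ⟨Equiv.ofBijective g (Finite.surjective_iff_bijective.mp hs), Finset.mem_univ _, rfl⟩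
  · simp

/-- Let `M`, `N` be abelian groups, `r : ℕ`, `f : M^r → N` a symmetric `ℤ`-multilinear
map, and `a : Fin r → M`. For `S ⊆ Fin r` write `σ_S := ∑_{t ∈ S} a t`. Then
`∑_{S ⊆ Fin r} (-1)^(r - |S|) • f (σ_S, …, σ_S) = r! • f (a 1, …, a r)`. -/
theorem stmt_6 (M N : Type*) [AddCommGroup M] [AddCommGroup N] (r : ℕ)
    (f : MultilinearMap ℤ (fun _ : Fin r => M) N)
    (hsymm : ∀ (π : Equiv.Perm (Fin r)) (x : Fin r → M), f (x ∘ π) = f x)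
    (a : Fin r → M) :
    ∑ S : Finset (Fin r),
      (-1 : ℤ) ^ (r - S.card) • f (fun _ => ∑ t ∈ S, a t)
      = (r.factorial : ℤ) • f a := by
  have expand (S : Finset (Fin r)) : f (fun _ => ∑ t ∈ S, a t) =
      ∑ g : Fin r → Fin r, if Finset.univ.image g ⊆ S then f (a ∘ g) else 0 := by
    rw [f.map_sum_finset (fun _ t => a t) (fun _ => S), ← Finset.sum_filter]
    refine Finset.sum_congr ?_ fun _ _ => rfl
    ext g
    simp [Fintype.mem_piFinset, Finset.image_subset_iff]
  have coeff (g : Fin r → Fin r) :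
      ∑ S : Finset (Fin r),
        (-1 : ℤ) ^ (r - S.card) • (if Finset.univ.image g ⊆ S then f (a ∘ g) else 0) =
      if Finset.univ.image g = Finset.univ then f (a ∘ g) else 0 := by
    have h := Finset.sum_superset_neg_one_pow_card_sub (Finset.univ.image g)
    rw [Fintype.card_fin] at h
    simp_rw [smul_ite, smul_zero]
    rw [← Finset.sum_filter, ← Finset.sum_smul, h, ite_smul, one_smul, zero_smul]
  simp_rw [expand, Finset.smul_sum]
  rw [Finset.sum_comm]
  simp_rw [coeff]
  rw [← Finset.sum_filter, Finset.sum_filter_surjective_eq_sum_perm fun g => f (a ∘ g)]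
  simp [hsymm, Fintype.card_perm]
end

section
/- Let M and N be abelian groups, let n be a natural number, let f : M^n → N be a ℤ-multilinear map in n variables, let a : Fin n → M, and let y ∈ M. For S ⊆ Fin n write σ_S := ∑_{t∈S} a_t. Then ∑_{S ⊆ Fin n} (−1)^{n−|S|} · f(y + σ_S, y + σ_S, …, y + σ_S) = ∑_{S ⊆ Fin n} (−1)^{n−|S|} · f(σ_S, σ_S, …, σ_S); that is, the alternating sum is unchanged by translating every argument by a fixed element y. -/
/-- The signed count of the supersets of a proper subset `T` of a finite type vanishes. -/
theorem sum_filter_superset_neg_one_pow {ι : Type*} [Fintype ι] [DecidableEq ι]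
    {T : Finset ι} (hT : T ≠ Finset.univ) :
    ∑ S : Finset ι with T ⊆ S, (-1 : ℤ) ^ (Fintype.card ι - S.card) = 0 := by
  rw [← Finset.sum_powerset_neg_one_pow_card_of_nonempty
    (Finset.nonempty_iff_ne_empty.2 fun h => hT (Finset.compl_eq_empty_iff T |>.1 h))]
  refine Finset.sum_bij' (fun S _ => Sᶜ) (fun S _ => Sᶜ) ?_ ?_ ?_ ?_ ?_
  · intro S hS
    simpa using hS
  · intro S hS
    simpa [Finset.subset_compl_comm] using hS
  · simp
  · simp
  · intro S _
    rw [Finset.card_compl]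

/-- A map `Fin n → Option (Fin n)` attaining `none` misses some `some t`. -/
theorem eraseNone_image_ne_univ {n : ℕ} {r : Fin n → Option (Fin n)} {i : Fin n}
    (hi : r i = none) : (Finset.univ.image r).eraseNone ≠ Finset.univ := by
  intro h
  have hc := Finset.card_eraseNone_of_mem (s := Finset.univ.image r)
    (Finset.mem_image.2 ⟨i, Finset.mem_univ i, hi⟩)
  have hle : (Finset.univ.image r).card ≤ n := by
    simpa using Finset.card_image_le (s := Finset.univ) (f := r)
  have hpos := i.pos
  rw [h, Finset.card_univ, Fintype.card_fin] at hc
  omega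

/-- Multilinear expansion of the alternating sum of `f (y + σ_S, …, y + σ_S)`, indexed by the
choice in each slot of either `y` or some `a t`. -/
theorem MultilinearMap.alternating_sum_add_eq {M N : Type*} [AddCommGroup M] [AddCommGroup N]
    {n : ℕ} (f : MultilinearMap ℤ (fun _ : Fin n => M) N) (a : Fin n → M) (y : M) :
    ∑ S : Finset (Fin n), (-1 : ℤ) ^ (n - S.card) • f (fun _ => y + ∑ t ∈ S, a t)
      = ∑ r : Fin n → Option (Fin n),
          (∑ S : Finset (Fin n) with (Finset.univ.image r).eraseNone ⊆ S,
            (-1 : ℤ) ^ (n - S.card)) • f (fun i => (r i).elim y a) := by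
  have expand (S : Finset (Fin n)) : f (fun _ => y + ∑ t ∈ S, a t)
      = ∑ r : Fin n → Option (Fin n) with (Finset.univ.image r).eraseNone ⊆ S,
          f (fun i => (r i).elim y a) := by
    have h := f.map_sum_finset (fun _ o => Option.elim o y a) (fun _ => Finset.insertNone S)
    simp only [Finset.sum_insertNone, Option.elim_none, Option.elim_some] at h
    rw [h]
    congr 1
    ext r
    simp only [Fintype.mem_piFinset, Finset.mem_insertNone, Finset.mem_filter, Finset.mem_univ,
      true_and, Finset.subset_iff, Finset.mem_eraseNone, Finset.mem_image, Option.mem_def]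
    exact ⟨fun h t ⟨i, hi⟩ => h i t hi, fun h i t hi => h ⟨i, hi⟩⟩
  simp only [expand, Finset.smul_sum, Finset.sum_smul, Finset.sum_filter, smul_ite, ite_smul,
    smul_zero, zero_smul]
  exact Finset.sum_comm


/-- Let `M`, `N` be abelian groups, `n : ℕ`, `f : M^n → N` a `ℤ`-multilinear map,
`a : Fin n → M`, and `y ∈ M`. For `S ⊆ Fin n` write `σ_S := ∑_{t ∈ S} a t`. Then the
alternating sum `∑_{S ⊆ Fin n} (-1)^(n - |S|) • f (y + σ_S, …, y + σ_S)` is unchanged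
by removing the translation by `y`. -/
theorem stmt_7 (M N : Type*) [AddCommGroup M] [AddCommGroup N] (n : ℕ)
    (f : MultilinearMap ℤ (fun _ : Fin n => M) N) (a : Fin n → M) (y : M) :
    ∑ S : Finset (Fin n),
      (-1 : ℤ) ^ (n - S.card) • f (fun _ => y + ∑ t ∈ S, a t)
      = ∑ S : Finset (Fin n),
          (-1 : ℤ) ^ (n - S.card) • f (fun _ => ∑ t ∈ S, a t) := by
  have key := f.alternating_sum_add_eq a
  have h0 := key 0
  simp only [zero_add] at h0
  rw [key y, h0]
  refine Finset.sum_congr rfl fun r _ => ?_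
  by_cases hr : ∃ i, r i = none
  · obtain ⟨i, hi⟩ := hr
    have hz := sum_filter_superset_neg_one_pow (eraseNone_image_ne_univ hi)
    rw [Fintype.card_fin] at hz
    rw [hz, zero_smul, zero_smul]
  · congr 2
    funext i
    obtain ⟨t, ht⟩ := Option.ne_none_iff_exists'.1 fun h => hr ⟨i, h⟩
    simp [ht]
end
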